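/- Let N, k be positive integers, Ω ⊂ ℝᴺ a bounded open set, and L, M nonempty index sets. Assume: (a) for each (λ,μ) ∈ L×M, continuous coefficients σ_{λμ} : Ω̄×[−1,1] → M(k, N+1), b_{λμ} : Ω̄×[−1,1] → ℝ^{N+1}, c_{λμ}, f_{λμ} : Ω̄×[−1,1] → ℝ with a uniform bound C_F on all of them, with σ_{λμ} and b_{λμ} Lipschitz in the space variable with constant C_F and c_{λμ}, f_{λμ} having a common modulus of continuity, and c_{λμ} ≥ 0; set A_{λμ} := σ_{λμ}ᵀσ_{λμ} and F(X, p, r, z) := inf_{λ∈L} sup_{μ∈M} (−tr(A_{λμ}(z) X) − b_{λμ}(z)·p + c_{λμ}(z) r − f_{λμ}(z)); (b) continuous vector fields γ^± = (γ₁^±, ±1) : Ω̄×[−1,1] → ℝ^{N+1} and functions β^± : Ω̄×[−1,1] → ℝ with γ₁^±(x,y) = ±γ₀(x) + O(|y|) and β^±(x,y) = ±β₀(x) + O(|y|) uniformly on Ω̄ as y → 0, where γ₀ ∈ C²(Ω̄, ℝᴺ) and β₀ ∈ C²(Ω̄, ℝ); (c) there exists s ∈ C²(Ω̄, ℝ)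 such that for every x ∈ Ω̄, inf_{(λ,μ)∈L×M} (Ds(x), −Ds(x)·γ₀ᵀ(x))·A_{λμ}(x,0)·(Ds(x), −Ds(x)·γ₀ᵀ(x))ᵀ > 0; (d) g^± ∈ C¹(Ω̄) with g⁻ < g⁺ on Ω̄. For ε > 0 let Ω_ε := {(x,y) : x ∈ Ω, ε g⁻(x) < y < ε g⁺(x)}, with top boundary ∂_T Ω_ε := {(x, ε g⁺(x)) : x ∈ Ω̄} and bottom boundary ∂_B Ω_ε := {(x, ε g⁻(x)) : x ∈ Ω̄}. Then there exist constants r ∈ (0,1), ε₁ ∈ (0,1), C > 0 and, for each ε ∈ (0, ε₁), functions ψ̄_ε, ψ_ε ∈ C²(Ω̄ × [−r, r]) such that: γ⁺·Dψ̄_ε − β⁺ > 0 on ∂_T Ω_ε; γ⁻·Dψ̄_ε − β⁻ > 0 on ∂_B Ω_ε; F(D²ψ̄_ε, Dψ̄_ε, ψ̄_ε, (x,y)) > 0 for all (x,y) in the closure of Ω_ε; γ⁺·Dψ_ε − β⁺ < 0 on ∂_T Ω_ε; γ⁻·Dψ_ε − β⁻ < 0 on ∂_B Ω_ε; F(D²ψ_ε,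 Dψ_ε, ψ_ε, (x,y)) < 0 on the closure of Ω_ε; and −C < ψ_ε < ψ̄_ε < C on the closure of Ω_ε. -/

import Mathlib

open Matrix

/-- Euclidean norm of a vector in `ℝⁿ`. -/
noncomputable def vnorm {n : ℕ} (v : Fin n → ℝ) : ℝ := Real.sqrt (∑ j, v j ^ 2)

/-- Frobenius norm of a real matrix. -/
noncomputable def matnorm {m n : ℕ} (A : Matrix (Fin m) (Fin n) ℝ) : ℝ :=
  Real.sqrt (∑ i, ∑ j, A i j ^ 2)

/-- Euclidean norm of a point `z = (x, y) ∈ ℝᴺ × ℝ = ℝ^{N+1}`. -/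
noncomputable def znorm {n : ℕ} (x : Fin n → ℝ) (y : ℝ) : ℝ :=
  Real.sqrt ((∑ j, x j ^ 2) + y ^ 2)

/-- Gradient as a vector of partial derivatives. -/
noncomputable def gradv {n : ℕ} (f : (Fin n → ℝ) → ℝ) (x : Fin n → ℝ) : Fin n → ℝ :=
  fun j => fderiv ℝ f x (Pi.single j 1)

/-- Hessian matrix of second partial derivatives. -/
noncomputable def hessv {n : ℕ} (f : (Fin n → ℝ) → ℝ) (x : Fin n → ℝ) :
    Matrix (Fin n) (Fin n) ℝ :=
  Matrix.of fun i j => fderiv ℝ (fun y => fderiv ℝ f y (Pi.single j 1)) x (Pi.single i 1)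

open MeasureTheory ContinuousLinearMap Metric in
/-- On a compact set, a `C¹` function is approximated by smooth functions in `C¹` norm. -/
theorem exists_contDiff_C1_approx {E : Type*} [NormedAddCommGroup E] [NormedSpace ℝ E]
    [FiniteDimensional ℝ E] {s : E → ℝ} (hs : ContDiff ℝ 1 s)
    {S : Set E} (hS : IsCompact S) {δ : ℝ} (hδ : 0 < δ) :
    ∃ t : E → ℝ, ContDiff ℝ 3 t ∧
      ∀ x ∈ S, |t x - s x| ≤ δ ∧ ‖fderiv ℝ t x - fderiv ℝ s x‖ ≤ δ := by
  borelize E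
  let ν : Measure E := Measure.addHaar
  obtain ⟨R, hR, hSR⟩ := hS.isBounded.subset_ball_lt 0 0
  let χ : ContDiffBump (0 : E) := ⟨R, R + 1, hR, by linarith⟩
  let u : E → ℝ := fun x => χ x * s x
  have hu : ContDiff ℝ 1 u := χ.contDiff.mul hs
  have hcu : HasCompactSupport u := χ.hasCompactSupport.mul_right
  have hus : ∀ x ∈ S, u =ᶠ[nhds x] s := fun x hx => by
    filter_upwards [χ.eventuallyEq_one_of_mem_ball (hSR hx)] with y hy
    simp [u, hy]
  have hu' : Continuous (fderiv ℝ u) := hu.continuous_fderiv one_ne_zero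
  obtain ⟨d₁, hd₁, h₁⟩ := Metric.uniformContinuous_iff.1
    (hcu.uniformContinuous_of_continuous hu.continuous) δ hδ
  obtain ⟨d₂, hd₂, h₂⟩ := Metric.uniformContinuous_iff.1
    ((hcu.fderiv ℝ).uniformContinuous_of_continuous hu') δ hδ
  let φ : ContDiffBump (0 : E) :=
    ⟨min d₁ d₂ / 2, min d₁ d₂, by positivity, half_lt_self (by positivity)⟩
  have hφ : LocallyIntegrable (φ.normed ν) ν := φ.continuous_normed.locallyIntegrable
  refine ⟨convolution (φ.normed ν) u (lsmul ℝ ℝ) ν,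
    φ.hasCompactSupport_normed.contDiff_convolution_left _ φ.contDiff_normed
      hu.continuous.locallyIntegrable, fun x hx => ⟨?_, ?_⟩⟩
  · rw [← (hus x hx).eq_of_nhds, ← Real.dist_eq]
    exact φ.dist_normed_convolution_le hu.continuous.aestronglyMeasurable fun y hy =>
      (h₁ ((mem_ball.1 hy).trans_le (min_le_left _ _))).le
  · rw [← (hus x hx).fderiv_eq, ← dist_eq_norm,
      (hcu.hasFDerivAt_convolution_right (lsmul ℝ ℝ) hφ hu x).fderiv]
    have hL : (lsmul ℝ ℝ : ℝ →L[ℝ] ℝ →L[ℝ] ℝ).precompR E = lsmul ℝ ℝ := by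
      ext; rfl
    rw [hL]
    exact φ.dist_normed_convolution_le hu'.aestronglyMeasurable fun y hy =>
      (h₂ ((mem_ball.1 hy).trans_le (min_le_right _ _))).le

theorem abs_entry_le_matnorm {m n : ℕ} (A : Matrix (Fin m) (Fin n) ℝ) (i : Fin m) (j : Fin n) :
    |A i j| ≤ matnorm A := by
  refine Real.abs_le_sqrt ?_
  calc A i j ^ 2 ≤ ∑ j, A i j ^ 2 :=
        Finset.single_le_sum (f := fun j => A i j ^ 2) (fun _ _ => sq_nonneg _) (Finset.mem_univ j)
    _ ≤ _ := Finset.single_le_sum (f := fun i => ∑ j, A i j ^ 2)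
        (fun _ _ => Finset.sum_nonneg fun _ _ => sq_nonneg _) (Finset.mem_univ i)

theorem abs_entry_le_vnorm {n : ℕ} (v : Fin n → ℝ) (j : Fin n) : |v j| ≤ vnorm v :=
  Real.abs_le_sqrt <|
    Finset.single_le_sum (f := fun j => v j ^ 2) (fun _ _ => sq_nonneg _) (Finset.mem_univ j)

theorem abs_dotProduct_le {n : ℕ} {v p : Fin n → ℝ} {C : ℝ} (hv : ∀ j, |v j| ≤ C) :
    |dotProduct v p| ≤ C * ∑ j, |p j| := by
  rw [dotProduct, Finset.mul_sum]
  refine (Finset.abs_sum_le_sum_abs _ _).trans (Finset.sum_le_sum fun j _ => ?_)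
  rw [abs_mul]
  exact mul_le_mul_of_nonneg_right (hv j) (abs_nonneg _)

theorem abs_mulVec_le {m n : ℕ} (A : Matrix (Fin m) (Fin n) ℝ) (p : Fin n → ℝ) (i : Fin m) :
    |(A *ᵥ p) i| ≤ matnorm A * ∑ j, |p j| :=
  abs_dotProduct_le fun j => abs_entry_le_matnorm A i j

theorem abs_trace_gram_mul_le {m n : ℕ} (A : Matrix (Fin m) (Fin n) ℝ)
    (X : Matrix (Fin n) (Fin n) ℝ) {C : ℝ} (hA : matnorm A ≤ C) :
    |trace (Aᵀ * A * X)| ≤ m * C ^ 2 * ∑ i, ∑ j, |X i j| := by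
  have hG : ∀ i j, |(Aᵀ * A) i j| ≤ m * C ^ 2 := fun i j => by
    rw [Matrix.mul_apply]
    refine (Finset.abs_sum_le_sum_abs _ _).trans ?_
    calc ∑ l, |Aᵀ i l * A l j| ≤ ∑ _l : Fin m, C ^ 2 := Finset.sum_le_sum fun l _ => by
          rw [abs_mul, sq, transpose_apply]
          have h₁ := (abs_entry_le_matnorm A l i).trans hA
          exact mul_le_mul h₁ ((abs_entry_le_matnorm A l j).trans hA) (abs_nonneg _)
            ((abs_nonneg _).trans h₁)
      _ = _ := by simp
  rw [trace, Finset.sum_comm, Finset.mul_sum]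
  refine (Finset.abs_sum_le_sum_abs _ _).trans (Finset.sum_le_sum fun i _ => ?_)
  rw [diag_apply, Matrix.mul_apply, Finset.mul_sum]
  refine (Finset.abs_sum_le_sum_abs _ _).trans (Finset.sum_le_sum fun j _ => ?_)
  rw [abs_mul]
  exact mul_le_mul_of_nonneg_right (hG _ _) (abs_nonneg _)

theorem dotProduct_vecMul_gram {m n : ℕ} (A : Matrix (Fin m) (Fin n) ℝ) (p : Fin n → ℝ) :
    dotProduct (vecMul p (Aᵀ * A)) p = ∑ i, (A *ᵥ p) i ^ 2 := by
  rw [← vecMul_vecMul, vecMul_transpose, ← dotProduct_mulVec]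
  simp [dotProduct, sq]

theorem trace_gram_mul_vecMulVec {m n : ℕ} (A : Matrix (Fin m) (Fin n) ℝ) (p : Fin n → ℝ) :
    trace (Aᵀ * A * vecMulVec p p) = ∑ i, (A *ᵥ p) i ^ 2 := by
  rw [← dotProduct_vecMul_gram, mul_vecMulVec, trace_vecMulVec, dotProduct_comm,
    dotProduct_mulVec]

/-- Stability of a sum of squares under a uniform perturbation of the entries. -/
theorem sum_sq_ge_of_abs_sub_le {m : ℕ} {q q₀ : Fin m → ℝ} {d : ℝ}
    (h : ∀ i, |q i - q₀ i| ≤ d) :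
    (∑ i, q₀ i ^ 2) / 2 - m * d ^ 2 ≤ ∑ i, q i ^ 2 := by
  have : (∑ i, q₀ i ^ 2) / 2 - m * d ^ 2 = ∑ i, (q₀ i ^ 2 / 2 - d ^ 2) := by
    simp [Finset.sum_sub_distrib, Finset.sum_div]
  rw [this]
  refine Finset.sum_le_sum fun i _ => ?_
  have h₁ := sq_le_sq' (abs_le.1 (h i)).1 (abs_le.1 (h i)).2
  nlinarith [sq_nonneg (2 * q i - q₀ i)]

theorem abs_mulVec_sub_mulVec_le {m n : ℕ} (A B : Matrix (Fin m) (Fin n) ℝ) (p q : Fin n → ℝ)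
    (i : Fin m) :
    |(A *ᵥ p) i - (B *ᵥ q) i| ≤
      matnorm (A - B) * (∑ j, |p j|) + matnorm B * ∑ j, |p j - q j| := by
  have : (A *ᵥ p) i - (B *ᵥ q) i = ((A - B) *ᵥ p) i + (B *ᵥ (p - q)) i := by
    rw [sub_mulVec, mulVec_sub]; simp
  rw [this]
  exact (abs_add_le _ _).trans (add_le_add (abs_mulVec_le _ _ _) (abs_mulVec_le _ _ _))

theorem dotProduct_gradv {n : ℕ} (u : (Fin n → ℝ) → ℝ) (v z : Fin n → ℝ) :
    dotProduct v (gradv u z) = fderiv ℝ u z v := by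
  conv_rhs => rw [pi_eq_sum_univ' v]
  simp [dotProduct, gradv, map_sum]

theorem gradv_lincomb {n : ℕ} {u v : (Fin n → ℝ) → ℝ} (hu : Differentiable ℝ u)
    (hv : Differentiable ℝ v) (a b : ℝ) (z : Fin n → ℝ) :
    gradv (fun z => a * u z + b * v z) z = a • gradv u z + b • gradv v z := by
  ext j
  simp only [gradv, Pi.add_apply, Pi.smul_apply, smul_eq_mul]
  have h : HasFDerivAt (fun z => a * u z + b * v z) _ z :=
    ((hu z).hasFDerivAt.const_mul a).add ((hv z).hasFDerivAt.const_mul b)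
  rw [h.fderiv]
  simp

theorem hessv_eq_gradv {n : ℕ} (u : (Fin n → ℝ) → ℝ) (z : Fin n → ℝ) (i j : Fin n) :
    hessv u z i j = gradv (fun y => gradv u y j) z i := rfl

theorem ContDiff.gradv_apply {n : ℕ} {m : WithTop ℕ∞} {u : (Fin n → ℝ) → ℝ}
    (hu : ContDiff ℝ (m + 1) u) (j : Fin n) : ContDiff ℝ m (fun z => gradv u z j) :=
  (hu.fderiv_right le_rfl).clm_apply contDiff_const

theorem hessv_lincomb {n : ℕ} {u v : (Fin n → ℝ) → ℝ} (hu : ContDiff ℝ 2 u)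
    (hv : ContDiff ℝ 2 v) (a b : ℝ) (z : Fin n → ℝ) :
    hessv (fun z => a * u z + b * v z) z = a • hessv u z + b • hessv v z := by
  ext i j
  have h1 : ∀ {u : (Fin n → ℝ) → ℝ}, ContDiff ℝ 2 u → Differentiable ℝ fun z => gradv u z j :=
    fun hu => (ContDiff.gradv_apply (m := 1) hu j).differentiable one_ne_zero
  simp only [hessv_eq_gradv, gradv_lincomb (hu.differentiable two_ne_zero)
    (hv.differentiable two_ne_zero), Pi.add_apply, Pi.smul_apply, smul_eq_mul, Matrix.add_apply,
    Matrix.smul_apply]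
  rw [gradv_lincomb (h1 hu) (h1 hv)]
  simp

theorem gradv_exp_neg_mul {n : ℕ} {u : (Fin n → ℝ) → ℝ} (hu : Differentiable ℝ u) (κ : ℝ)
    (z : Fin n → ℝ) :
    gradv (fun z => Real.exp (-κ * u z)) z = (-κ * Real.exp (-κ * u z)) • gradv u z := by
  ext j
  simp only [gradv, Pi.smul_apply, smul_eq_mul]
  rw [((hu z).hasFDerivAt.const_mul (-κ)).exp.fderiv]
  simp; ring

theorem hessv_exp_neg_mul {n : ℕ} {u : (Fin n → ℝ) → ℝ} (hu : ContDiff ℝ 2 u) (κ : ℝ)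
    (z : Fin n → ℝ) :
    hessv (fun z => Real.exp (-κ * u z)) z =
      (-κ * Real.exp (-κ * u z)) • (hessv u z - κ • vecMulVec (gradv u z) (gradv u z)) := by
  have hd := hu.differentiable two_ne_zero
  ext i j
  simp only [hessv_eq_gradv, gradv_exp_neg_mul hd, Pi.smul_apply, smul_eq_mul, Matrix.smul_apply,
    Matrix.sub_apply, vecMulVec_apply]
  have h1 : Differentiable ℝ fun z => gradv u z j :=
    (ContDiff.gradv_apply (m := 1) hu j).differentiable one_ne_zero
  have h2 : HasFDerivAt (fun y => -κ * Real.exp (-κ * u y) * gradv u y j) _ z :=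
    (((hd z).hasFDerivAt.const_mul (-κ)).exp.const_mul (-κ)).mul (h1 z).hasFDerivAt
  conv_lhs => rw [gradv, h2.fderiv]
  simp [gradv]; ring

/-- Values and derivatives up to order two of a `C²` function are bounded on compact sets. -/
theorem exists_bound_C2 {n : ℕ} {u : (Fin n → ℝ) → ℝ} (hu : ContDiff ℝ 2 u)
    {S : Set (Fin n → ℝ)} (hS : IsCompact S) :
    ∃ C, 0 ≤ C ∧ ∀ z ∈ S, |u z| ≤ C ∧ ∑ j, |gradv u z j| ≤ C ∧
      ∑ i, ∑ j, |hessv u z i j| ≤ C := by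
  have h1 : ∀ j, ContDiff ℝ 1 fun z => gradv u z j := fun j => ContDiff.gradv_apply hu j
  have h2 : ∀ i j, Continuous fun z => hessv u z i j := fun i j =>
    (ContDiff.gradv_apply (m := 0) (h1 j) i).continuous
  have hc : Continuous fun z => |u z| + ∑ j, |gradv u z j| + ∑ i, ∑ j, |hessv u z i j| :=
    (hu.continuous.abs.add (continuous_finsetSum _ fun j _ => (h1 j).continuous.abs)).add
      (continuous_finsetSum _ fun i _ => continuous_finsetSum _ fun j _ => (h2 i j).abs)
  obtain ⟨C, hC⟩ := hS.exists_bound_of_continuousOn hc.continuousOn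
  refine ⟨max C 0, le_max_right _ _, fun z hz => ?_⟩
  have h := (le_abs_self _).trans ((hC z hz).trans (le_max_left C 0))
  have a1 : 0 ≤ |u z| := abs_nonneg _
  have a2 : 0 ≤ ∑ j, |gradv u z j| := Finset.sum_nonneg fun _ _ => abs_nonneg _
  have a3 : 0 ≤ ∑ i, ∑ j, |hessv u z i j| :=
    Finset.sum_nonneg fun _ _ => Finset.sum_nonneg fun _ _ => abs_nonneg _
  exact ⟨by linarith, by linarith, by linarith⟩

theorem gradv_add_const {n : ℕ} (u : (Fin n → ℝ) → ℝ) (c : ℝ) :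
    gradv (fun z => u z + c) = gradv u := by
  ext z j; simp [gradv]

theorem hessv_add_const {n : ℕ} (u : (Fin n → ℝ) → ℝ) (c : ℝ) :
    hessv (fun z => u z + c) = hessv u := by
  ext z i j; simp [hessv]

/-- The projection `(x, y) ↦ x` from `ℝᴺ × ℝ` to `ℝᴺ`. -/
def initL (N : ℕ) : (Fin (N + 1) → ℝ) →L[ℝ] (Fin N → ℝ) :=
  ContinuousLinearMap.pi fun i => ContinuousLinearMap.proj i.castSucc

@[simp] theorem initL_snoc {N : ℕ} (x : Fin N → ℝ) (y : ℝ) :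
    initL N (Fin.snoc x y : Fin (N + 1) → ℝ) = x := by
  ext i; simp [initL]

/-- The function `s(x) + y w(x) + Λ (y² / 2 - ε y g(x))` of `z = (x, y)`. -/
noncomputable def thinProfile {N : ℕ} (s w g : (Fin N → ℝ) → ℝ) (Λ ε : ℝ)
    (z : Fin (N + 1) → ℝ) : ℝ :=
  s (initL N z) + z (Fin.last N) * w (initL N z) +
    Λ * (z (Fin.last N) ^ 2 / 2 - ε * (z (Fin.last N) * g (initL N z)))

section ThinProfile

variable {N : ℕ} {s w g : (Fin N → ℝ) → ℝ}

theorem contDiff_thinProfile (hs : ContDiff ℝ 2 s) (hw : ContDiff ℝ 2 w) (hg : ContDiff ℝ 2 g)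
    (Λ ε : ℝ) : ContDiff ℝ 2 (thinProfile s w g Λ ε) := by
  have hl : ContDiff ℝ 2 fun z : Fin (N + 1) → ℝ => z (Fin.last N) := contDiff_apply ℝ ℝ _
  have hi : ContDiff ℝ 2 (initL N) := (initL N).contDiff
  exact ((hs.comp hi).add (hl.mul (hw.comp hi))).add
    (contDiff_const.mul (((hl.pow 2).div_const 2).sub
      (contDiff_const.mul (hl.mul (hg.comp hi)))))

theorem fderiv_thinProfile (hs : Differentiable ℝ s) (hw : Differentiable ℝ w)
    (hg : Differentiable ℝ g) (Λ ε : ℝ) (x v : Fin N → ℝ) (y a : ℝ) :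
    fderiv ℝ (thinProfile s w g Λ ε) (Fin.snoc x y) (Fin.snoc v a) =
      fderiv ℝ s x v + y * fderiv ℝ w x v + a * w x + Λ * (a * (y - ε * g x)) -
        Λ * ε * y * fderiv ℝ g x v := by
  set z : Fin (N + 1) → ℝ := Fin.snoc x y with hz
  have hl : HasFDerivAt (fun z : Fin (N + 1) → ℝ => z (Fin.last N)) _ z :=
    (ContinuousLinearMap.proj (R := ℝ) (φ := fun _ : Fin (N + 1) => ℝ) (Fin.last N)).hasFDerivAt
  have hc : ∀ {u : (Fin N → ℝ) → ℝ}, Differentiable ℝ u →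
      HasFDerivAt (fun z => u (initL N z)) ((fderiv ℝ u x).comp (initL N)) z := fun {u} hu => by
    have h := (hu (initL N z)).hasFDerivAt.comp z (initL N).hasFDerivAt
    rwa [hz, initL_snoc, ← hz] at h
  have h : HasFDerivAt (thinProfile s w g Λ ε) _ z :=
    ((hc hs).add (hl.mul (hc hw))).add
      ((((hl.pow 2).mul_const 2⁻¹).sub ((hl.mul (hc hg)).const_mul ε)).const_mul Λ)
  rw [h.fderiv]
  simp [hz]
  ring

theorem gradv_thinProfile_castSucc (hs : Differentiable ℝ s) (hw : Differentiable ℝ w)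
    (hg : Differentiable ℝ g) (Λ ε : ℝ) (x : Fin N → ℝ) (y : ℝ) (j : Fin N) :
    gradv (thinProfile s w g Λ ε) (Fin.snoc x y) j.castSucc =
      gradv s x j + y * (gradv w x j - Λ * ε * gradv g x j) := by
  have h : (Pi.single j.castSucc 1 : Fin (N + 1) → ℝ) = Fin.snoc (Pi.single j 1) 0 := by
    ext i
    refine Fin.lastCases ?_ (fun i => ?_) i
    · simp
    · simp [Pi.single_apply]
  rw [gradv, h, fderiv_thinProfile hs hw hg]
  simp only [gradv]; ring

theorem gradv_thinProfile_last (hs : Differentiable ℝ s) (hw : Differentiable ℝ w)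
    (hg : Differentiable ℝ g) (Λ ε : ℝ) (x : Fin N → ℝ) (y : ℝ) :
    gradv (thinProfile s w g Λ ε) (Fin.snoc x y) (Fin.last N) = w x + Λ * (y - ε * g x) := by
  have h : (Pi.single (Fin.last N) 1 : Fin (N + 1) → ℝ) = Fin.snoc (0 : Fin N → ℝ) 1 := by
    ext i
    refine Fin.lastCases ?_ (fun i => ?_) i
    · simp
    · simp [Fin.castSucc_ne_last]
  rw [gradv, h, fderiv_thinProfile hs hw hg]
  simp

theorem sum_abs_gradv_thinProfile_sub_le (hs : Differentiable ℝ s) (hw : Differentiable ℝ w)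
    (hg : Differentiable ℝ g) {Λ ε G Cw Cg : ℝ} (hΛ : 0 ≤ Λ) (hε : 0 ≤ ε) (hε1 : ε ≤ 1)
    {x : Fin N → ℝ} {y : ℝ} (hy : |y| ≤ ε * G) (hCw : ∑ j, |gradv w x j| ≤ Cw)
    (hCg : ∑ j, |gradv g x j| ≤ Cg) (hCg' : |g x| ≤ Cg) :
    ∑ j, |gradv (thinProfile s w g Λ ε) (Fin.snoc x y) j -
        (Fin.snoc (gradv s x) (w x) : Fin (N + 1) → ℝ) j| ≤
      ε * (G * (Cw + Λ * Cg) + Λ * (G + Cg)) := by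
  have hCg0 : 0 ≤ Cg := (abs_nonneg _).trans hCg'
  rw [Fin.sum_univ_castSucc]
  simp only [gradv_thinProfile_castSucc hs hw hg, gradv_thinProfile_last hs hw hg,
    Fin.snoc_castSucc, Fin.snoc_last, add_sub_cancel_left, abs_mul, abs_of_nonneg hΛ]
  rw [← Finset.mul_sum]
  have h1 : ∑ j, |gradv w x j - Λ * ε * gradv g x j| ≤ Cw + Λ * Cg := by
    calc _ ≤ ∑ j, (|gradv w x j| + Λ * ε * |gradv g x j|) := Finset.sum_le_sum fun j _ => by
          refine (abs_sub _ _).trans_eq ?_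
          rw [abs_mul, abs_of_nonneg (mul_nonneg hΛ hε)]
      _ = ∑ j, |gradv w x j| + Λ * ε * ∑ j, |gradv g x j| := by
          rw [Finset.sum_add_distrib, Finset.mul_sum]
      _ ≤ Cw + Λ * Cg := by
          have : Λ * ε * ∑ j, |gradv g x j| ≤ Λ * 1 * Cg :=
            mul_le_mul (mul_le_mul_of_nonneg_left hε1 hΛ) hCg
              (Finset.sum_nonneg fun _ _ => abs_nonneg _) (by positivity)
          linarith
  have h2 : |y - ε * g x| ≤ ε * (G + Cg) := by
    refine (abs_sub _ _).trans ?_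
    rw [abs_mul, abs_of_nonneg hε, mul_add]
    exact add_le_add hy (mul_le_mul_of_nonneg_left hCg' hε)
  calc _ ≤ ε * G * (Cw + Λ * Cg) + Λ * (ε * (G + Cg)) :=
        add_le_add (mul_le_mul hy h1 (Finset.sum_nonneg fun _ _ => abs_nonneg _)
          ((abs_nonneg _).trans hy)) (mul_le_mul_of_nonneg_left h2 hΛ)
    _ = _ := by ring

theorem exists_bound_thinProfile (hs : ContDiff ℝ 2 s) (hw : ContDiff ℝ 2 w)
    (hg : ContDiff ℝ 2 g) {S : Set (Fin N → ℝ)} (hS : IsCompact S) {Λ : ℝ} (hΛ : 0 ≤ Λ) :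
    ∃ C, 0 ≤ C ∧ ∀ ε, 0 ≤ ε → ε ≤ 1 → ∀ x ∈ S, ∀ y ∈ Set.Icc (-1 : ℝ) 1,
      |thinProfile s w g Λ ε (Fin.snoc x y)| ≤ C ∧
      ∑ j, |gradv (thinProfile s w g Λ ε) (Fin.snoc x y) j| ≤ C ∧
      ∑ i, ∑ j, |hessv (thinProfile s w g Λ ε) (Fin.snoc x y) i j| ≤ C := by
  have hP := contDiff_thinProfile hs hw hg Λ 0
  have hR : ContDiff ℝ 2 (thinProfile 0 g 0 0 0) :=
    contDiff_thinProfile contDiff_const hg contDiff_const 0 0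
  have hsplit : ∀ ε, thinProfile s w g Λ ε =
      fun z => 1 * thinProfile s w g Λ 0 z + (-(Λ * ε)) * thinProfile 0 g 0 0 0 z := fun ε => by
    ext z; simp [thinProfile]; ring
  have hc : Continuous fun p : (Fin N → ℝ) × ℝ => (Fin.snoc p.1 p.2 : Fin (N + 1) → ℝ) :=
    Continuous.finSnoc (A := fun _ => ℝ) continuous_fst continuous_snd
  have hD := (hS.prod (isCompact_Icc (a := (-1 : ℝ)) (b := 1))).image hc
  obtain ⟨C₁, hC₁, h₁⟩ := exists_bound_C2 hP hD
  obtain ⟨C₂, hC₂, h₂⟩ := exists_bound_C2 hR hD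
  refine ⟨C₁ + Λ * C₂, by positivity, fun ε hε hε1 x hx y hy => ?_⟩
  have hz : (Fin.snoc x y : Fin (N + 1) → ℝ) ∈
      (fun p : (Fin N → ℝ) × ℝ => (Fin.snoc p.1 p.2 : Fin (N + 1) → ℝ)) ''
        (S ×ˢ Set.Icc (-1 : ℝ) 1) := ⟨(x, y), ⟨hx, hy⟩, rfl⟩
  obtain ⟨a₁, b₁, c₁⟩ := h₁ _ hz
  obtain ⟨a₂, b₂, c₂⟩ := h₂ _ hz
  have key : ∀ p q : ℝ, |1 * p + (-(Λ * ε)) * q| ≤ |p| + Λ * |q| := fun p q => by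
    refine (abs_add_le _ _).trans ?_
    rw [abs_mul, abs_mul, abs_neg, abs_of_nonneg (mul_nonneg hΛ hε), abs_one, one_mul]
    gcongr
    exact mul_le_of_le_one_right hΛ hε1
  rw [hsplit ε]
  refine ⟨?_, ?_, ?_⟩
  · exact (key _ _).trans (by gcongr)
  · rw [gradv_lincomb (hP.differentiable two_ne_zero) (hR.differentiable two_ne_zero)]
    refine (Finset.sum_le_sum fun j _ => key _ _).trans ?_
    rw [Finset.sum_add_distrib, ← Finset.mul_sum]
    gcongr
  · rw [hessv_lincomb hP hR]
    refine (Finset.sum_le_sum fun i _ => Finset.sum_le_sum fun j _ => key _ _).trans ?_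
    simp only [Finset.sum_add_distrib, ← Finset.mul_sum]
    gcongr

/-- The oblique derivative of a thin profile beats the datum `b` at points whose signed vertical
distance from the graph of `ε g` is at least `ε δ`. -/
theorem lt_fderiv_thinProfile (hs : Differentiable ℝ s) (hw : Differentiable ℝ w)
    (hg : Differentiable ℝ g) {Λ ε G δ C₁ Cw Cg V a b : ℝ} (hΛ : 0 < Λ) (hε : 0 < ε)
    {x v : Fin N → ℝ} {y : ℝ} (hy : |y| ≤ ε * G) (hv : ∀ j, |v j| ≤ V) (hV : 0 ≤ V)
    (hC₁ : |fderiv ℝ s x v + a * w x - b| ≤ C₁ * |y|) (hC₁0 : 0 ≤ C₁)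
    (hCw : ∑ j, |gradv w x j| ≤ Cw) (hCg : ∑ j, |gradv g x j| ≤ Cg)
    (hδ : ε * δ ≤ a * (y - ε * g x)) (hΛδ : 2 * (G * (C₁ + V * Cw)) < Λ * δ)
    (hεδ : ε * (2 * (G * (V * Cg))) ≤ δ) :
    b < fderiv ℝ (thinProfile s w g Λ ε) (Fin.snoc x y) (Fin.snoc v a) := by
  have bd : ∀ {u : (Fin N → ℝ) → ℝ} {C : ℝ}, ∑ j, |gradv u x j| ≤ C → |fderiv ℝ u x v| ≤ V * C :=
    fun {u C} h => by
      rw [← dotProduct_gradv]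
      exact (abs_dotProduct_le hv).trans (mul_le_mul_of_nonneg_left h hV)
  have hw' : |y * fderiv ℝ w x v| ≤ ε * G * (V * Cw) := by
    rw [abs_mul]
    exact mul_le_mul hy (bd hCw) (abs_nonneg _) ((abs_nonneg _).trans hy)
  have hg' : |y * fderiv ℝ g x v| ≤ ε * G * (V * Cg) := by
    rw [abs_mul]
    exact mul_le_mul hy (bd hCg) (abs_nonneg _) ((abs_nonneg _).trans hy)
  have h₁ := hC₁.trans (mul_le_mul_of_nonneg_left hy hC₁0)
  rw [fderiv_thinProfile hs hw hg]
  have e₁ := (abs_le.1 h₁).1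
  have e₂ := (abs_le.1 hw').1
  have e₃ : Λ * ε * (y * fderiv ℝ g x v) ≤ Λ * ε * (δ / 2) :=
    mul_le_mul_of_nonneg_left ((le_abs_self _).trans (hg'.trans (by linarith))) (by positivity)
  have e₄ := mul_le_mul_of_nonneg_left hδ hΛ.le
  have e₅ := mul_lt_mul_of_pos_left hΛδ hε
  linarith

end ThinProfile

/-- Pointwise lower bound for a linear elliptic operator applied to `Q - μ exp (-κ Φ) + C₀`. -/
theorem le_elliptic_exp {m n : ℕ} (A : Matrix (Fin m) (Fin n) ℝ) (b : Fin n → ℝ)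
    {Φ Q : (Fin n → ℝ) → ℝ} (hΦ : ContDiff ℝ 2 Φ) (hQ : ContDiff ℝ 2 Q)
    {z : Fin n → ℝ} {C CΦ CQ η κ μ T : ℝ} (hC : 0 ≤ C) (hA : matnorm A ≤ C) (hb : vnorm b ≤ C)
    (hell : η ≤ ∑ i, (A *ᵥ gradv Φ z) i ^ 2) (hΦ₁ : ∑ j, |gradv Φ z j| ≤ CΦ)
    (hΦ₂ : ∑ i, ∑ j, |hessv Φ z i j| ≤ CΦ) (hQ₁ : ∑ j, |gradv Q z j| ≤ CQ)
    (hQ₂ : ∑ i, ∑ j, |hessv Q z i j| ≤ CQ) (hκ : 0 ≤ κ) (hμ : 0 ≤ μ)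
    (hκη : (m * C ^ 2 + C) * CΦ + 1 ≤ κ * η)
    (hT : T + (m * C ^ 2 + C) * CQ ≤ μ * κ * Real.exp (-κ * Φ z)) (C₀ : ℝ) :
    T ≤ -(trace (Aᵀ * A * hessv (fun z => (-μ) * Real.exp (-κ * Φ z) + 1 * Q z + C₀) z)) -
      dotProduct b (gradv (fun z => (-μ) * Real.exp (-κ * Φ z) + 1 * Q z + C₀) z) := by
  have hE : ContDiff ℝ 2 fun z => Real.exp (-κ * Φ z) := (contDiff_const.mul hΦ).exp
  have hd := hΦ.differentiable two_ne_zero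
  rw [hessv_add_const, gradv_add_const, hessv_lincomb hE hQ,
    gradv_lincomb (hE.differentiable two_ne_zero) (hQ.differentiable two_ne_zero),
    hessv_exp_neg_mul hΦ, gradv_exp_neg_mul hd]
  simp only [mul_add, mul_smul_comm, mul_sub, trace_add, trace_sub, trace_smul, dotProduct_add,
    dotProduct_smul, trace_gram_mul_vecMulVec, smul_eq_mul]
  set h := Real.exp (-κ * Φ z)
  have hh : 0 ≤ μ * κ * h := by positivity
  have hbound : ∀ {u : (Fin n → ℝ) → ℝ} {D : ℝ}, ∑ j, |gradv u z j| ≤ D →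
      ∑ i, ∑ j, |hessv u z i j| ≤ D →
      trace (Aᵀ * A * hessv u z) + dotProduct b (gradv u z) ≤ (m * C ^ 2 + C) * D := by
    intro u D h₁ h₂
    have t₁ := (le_abs_self _).trans (abs_trace_gram_mul_le A (hessv u z) hA)
    have t₂ := (le_abs_self _).trans
      (abs_dotProduct_le (p := gradv u z) fun j => (abs_entry_le_vnorm b j).trans hb)
    have t₃ := mul_le_mul_of_nonneg_left h₂ (by positivity : 0 ≤ m * C ^ 2)
    have t₄ := mul_le_mul_of_nonneg_left h₁ hC
    linarith
  have B₁ := hbound hΦ₁ hΦ₂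
  have B₂ := hbound hQ₁ hQ₂
  have B₃ : 1 ≤ κ * (∑ i, (A *ᵥ gradv Φ z) i ^ 2) -
      (trace (Aᵀ * A * hessv Φ z) + dotProduct b (gradv Φ z)) := by
    linarith [mul_le_mul_of_nonneg_left hell hκ]
  have B₄ := mul_le_mul_of_nonneg_left B₃ hh
  linarith

/-- Strict classical supersolutions of the linear problems in thin domains, uniformly in the
linear operator and for all small `ε`. -/
theorem exists_strict_supersolution {N k : ℕ} {ι : Type*} {S : Set (Fin N → ℝ)} (hS : IsCompact S)
    {σ : ι → (Fin N → ℝ) → ℝ → Matrix (Fin k) (Fin (N + 1)) ℝ}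
    {b : ι → (Fin N → ℝ) → ℝ → (Fin (N + 1) → ℝ)} {C : ℝ} (hC : 0 ≤ C)
    (hσ : ∀ i, ∀ x ∈ S, ∀ y ∈ Set.Icc (-1 : ℝ) 1, matnorm (σ i x y) ≤ C)
    (hb : ∀ i, ∀ x ∈ S, ∀ y ∈ Set.Icc (-1 : ℝ) 1, vnorm (b i x y) ≤ C)
    (hlip : ∀ i, ∀ x ∈ S, ∀ y ∈ Set.Icc (-1 : ℝ) 1, matnorm (σ i x y - σ i x 0) ≤ C * |y|)
    {γ₀ : (Fin N → ℝ) → (Fin N → ℝ)} {β₀ s g : (Fin N → ℝ) → ℝ} (hγ₀ : ContDiff ℝ 2 γ₀)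
    (hβ₀ : ContDiff ℝ 2 β₀) (hs : ContDiff ℝ 3 s) (hg : ContDiff ℝ 2 g)
    {K η δ G : ℝ} (hK : 0 ≤ K) (hη : 0 < η) (hδ : 0 < δ) (hG : 0 ≤ G)
    (hell : ∀ i, ∀ x ∈ S, η ≤ ∑ j, (σ i x 0 *ᵥ
      (Fin.snoc (gradv s x) (-(dotProduct (gradv s x) (γ₀ x))) : Fin (N + 1) → ℝ)) j ^ 2)
    (T : ℝ) :
    ∃ ε₁ ∈ Set.Ioo (0 : ℝ) 1, ∃ B : ℝ, 0 < B ∧ ∀ ε, 0 < ε → ε < ε₁ → ε * G ≤ 1 ∧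
      ∃ ψ : (Fin (N + 1) → ℝ) → ℝ, ContDiff ℝ 2 ψ ∧
        (∀ x ∈ S, ∀ (y a β : ℝ) (v : Fin N → ℝ), |a| = 1 → |y| ≤ ε * G →
          ε * δ ≤ a * (y - ε * g x) → vnorm (v - a • γ₀ x) ≤ K * |y| → |a * β₀ x - β| ≤ K * |y| →
          β < dotProduct (Fin.snoc v a : Fin (N + 1) → ℝ) (gradv ψ (Fin.snoc x y))) ∧
        (∀ x ∈ S, ∀ y : ℝ, |y| ≤ ε * G → 0 < ψ (Fin.snoc x y) ∧ ψ (Fin.snoc x y) < B ∧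
          ∀ i, T ≤ -(trace ((σ i x y)ᵀ * σ i x y * hessv ψ (Fin.snoc x y))) -
            dotProduct (b i x y) (gradv ψ (Fin.snoc x y))) := by
  have hs2 : ContDiff ℝ 2 s := hs.of_le (by norm_num)
  have hsd := hs2.differentiable two_ne_zero
  set w : (Fin N → ℝ) → ℝ := fun x => -(dotProduct (gradv s x) (γ₀ x)) with hwdef
  have hw : ContDiff ℝ 2 w := by
    refine ContDiff.neg (ContDiff.sum fun j _ => ContDiff.mul ?_ (contDiff_pi.1 hγ₀ j))
    exact ContDiff.gradv_apply (m := 2) (by norm_num; exact hs) j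
  have hwd := hw.differentiable two_ne_zero
  have hgd := hg.differentiable two_ne_zero
  have hβd := hβ₀.differentiable two_ne_zero
  obtain ⟨Cs, hCs, bs⟩ := exists_bound_C2 hs2 hS
  obtain ⟨Cw, hCw, bw⟩ := exists_bound_C2 hw hS
  obtain ⟨Cβ, hCβ, bβ⟩ := exists_bound_C2 hβ₀ hS
  obtain ⟨Cg, hCg, bg⟩ := exists_bound_C2 hg hS
  obtain ⟨Vγ, hVγ⟩ := hS.exists_bound_of_continuousOn hγ₀.continuous.continuousOn
  let V := |Vγ| + K
  have hV : 0 ≤ V := by positivity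
  let C₁ := K * (Cs + 1)
  have hC₁ : 0 ≤ C₁ := by positivity
  obtain ⟨Λ, hΛ, hΛδ⟩ : ∃ Λ : ℝ, 0 < Λ ∧ 2 * (G * (C₁ + V * (Cw + Cβ))) < Λ * δ :=
    ⟨(2 * (G * (C₁ + V * (Cw + Cβ))) + 1) / δ, by positivity, by
      rw [div_mul_cancel₀ _ hδ.ne']; linarith⟩
  obtain ⟨CΦ, hCΦ, bΦ⟩ := exists_bound_thinProfile hs2 hw hg hS hΛ.le
  obtain ⟨CQ, hCQ, bQ⟩ := exists_bound_thinProfile (s := fun _ => 0) contDiff_const hβ₀ hg hS hΛ.le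
  obtain ⟨κ, hκ, hκη⟩ : ∃ κ : ℝ, 0 < κ ∧ (k * C ^ 2 + C) * CΦ + 1 ≤ κ * (η / 4) :=
    ⟨((k * C ^ 2 + C) * CΦ + 1) / (η / 4), by positivity, by
      rw [div_mul_cancel₀ _ (by positivity)]⟩
  obtain ⟨μ, hμ, hμT⟩ : ∃ μ : ℝ, 0 ≤ μ ∧
      T + (k * C ^ 2 + C) * CQ ≤ μ * (κ * Real.exp (-κ * CΦ)) := by
    refine ⟨(max T 0 + (k * C ^ 2 + C) * CQ) / (κ * Real.exp (-κ * CΦ)), by positivity, ?_⟩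
    rw [div_mul_cancel₀ _ (by positivity)]
    gcongr
    exact le_max_left _ _
  let C₀ := μ * Real.exp (κ * CΦ) + CQ + 1
  let Cd := C * (G * CΦ) + C * (G * (Cw + Λ * Cg) + Λ * (G + Cg))
  have hCd : 0 ≤ Cd := by positivity
  let H := 1 + G + 2 * (G * (V * Cg)) + k * Cd ^ 2
  have hH : 0 < H := by positivity
  let τ := min 1 (min δ (η / 4))
  have hτ : 0 < τ := by positivity
  refine ⟨min (1 / 2) (τ / H), ⟨by positivity, (min_le_left _ _).trans_lt (by norm_num)⟩,
    C₀ + CQ + 1, by positivity, fun ε hε hε₁ => ?_⟩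
  have hε1 : ε ≤ 1 := by linarith [hε₁.trans_le (min_le_left _ _)]
  have hεH : ε * H ≤ τ := by
    have := (hε₁.trans_le (min_le_right _ _)).le
    rwa [le_div_iff₀ hH] at this
  have hτ1 : τ ≤ 1 := min_le_left _ _
  have hτδ : τ ≤ δ := (min_le_right _ _).trans (min_le_left _ _)
  have hτη : τ ≤ η / 4 := (min_le_right _ _).trans (min_le_right _ _)
  have part : ∀ q, q ≤ H → ε * q ≤ τ := fun q hq =>
    (mul_le_mul_of_nonneg_left hq hε.le).trans hεH
  have p₁ : 0 ≤ G * (V * Cg) := by positivity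
  have p₂ : 0 ≤ k * Cd ^ 2 := by positivity
  have hεG : ε * G ≤ 1 := (part G (by simp only [H]; linarith)).trans hτ1
  have hεδ : ε * (2 * (G * (V * Cg))) ≤ δ := (part _ (by simp only [H]; linarith)).trans hτδ
  have hεη : ε * (k * Cd ^ 2) ≤ η / 4 := (part _ (by simp only [H]; linarith)).trans hτη
  have hyI : ∀ y, |y| ≤ ε * G → y ∈ Set.Icc (-1 : ℝ) 1 := fun y hy => abs_le.1 (hy.trans hεG)
  set Φ : (Fin (N + 1) → ℝ) → ℝ := thinProfile s w g Λ ε with hΦdef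
  set Q : (Fin (N + 1) → ℝ) → ℝ := thinProfile (fun _ => 0) β₀ g Λ ε with hQdef
  have hΦ : ContDiff ℝ 2 Φ := contDiff_thinProfile hs2 hw hg Λ ε
  have hQ : ContDiff ℝ 2 Q := contDiff_thinProfile contDiff_const hβ₀ hg Λ ε
  have hE : ContDiff ℝ 2 fun z => Real.exp (-κ * Φ z) := (contDiff_const.mul hΦ).exp
  refine ⟨hεG, fun z => (-μ) * Real.exp (-κ * Φ z) + 1 * Q z + C₀,
    ((contDiff_const.mul hE).add (contDiff_const.mul hQ)).add contDiff_const, ?_, ?_⟩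
  · intro x hx y a β v ha hy hya hv hβ
    have ha' : ∀ t : ℝ, |a * t| = |t| := fun t => by rw [abs_mul, ha, one_mul]
    have hvV : ∀ j, |v j| ≤ V := fun j => by
      have h1 := (abs_entry_le_vnorm (v - a • γ₀ x) j).trans hv
      have h2 : |γ₀ x j| ≤ |Vγ| :=
        ((norm_le_pi_norm (γ₀ x) j).trans (hVγ x hx)).trans (le_abs_self _)
      have h3 : K * |y| ≤ K := mul_le_of_le_one_right hK (hy.trans hεG)
      have h4 : v j = (v - a • γ₀ x) j + a * γ₀ x j := by simp
      rw [h4]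
      refine (abs_add_le _ _).trans ?_
      rw [ha']
      linarith
    have hΦ₁ : |fderiv ℝ s x v + a * w x - 0| ≤ C₁ * |y| := by
      have h1 : fderiv ℝ s x v + a * w x - 0 = dotProduct (v - a • γ₀ x) (gradv s x) := by
        rw [sub_dotProduct, smul_dotProduct, dotProduct_gradv, ← dotProduct_comm (gradv s x)]
        simp [hwdef, sub_eq_add_neg]
      rw [h1]
      calc _ ≤ K * |y| * ∑ j, |gradv s x j| :=
            abs_dotProduct_le fun j => (abs_entry_le_vnorm _ j).trans hv
        _ ≤ K * |y| * (Cs + 1) := by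
            gcongr
            linarith [(bs x hx).2.1]
        _ = _ := by ring
    have hQ₁ : |fderiv ℝ (fun _ : Fin N → ℝ => (0 : ℝ)) x v + a * β₀ x - β| ≤ C₁ * |y| := by
      simp only [fderiv_fun_const, Pi.zero_apply, _root_.zero_apply, zero_add]
      refine hβ.trans (mul_le_mul_of_nonneg_right ?_ (abs_nonneg _))
      exact le_mul_of_one_le_right hK (by linarith)
    have hΦpos := lt_fderiv_thinProfile hsd hwd hgd hΛ hε hy hvV hV hΦ₁ hC₁
      ((bw x hx).2.1.trans (by linarith)) (bg x hx).2.1 hya hΛδ hεδ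
    have hQpos := lt_fderiv_thinProfile (differentiable_const _) hβd hgd hΛ hε hy hvV hV hQ₁ hC₁
      ((bβ x hx).2.1.trans (by linarith)) (bg x hx).2.1 hya hΛδ hεδ
    rw [gradv_add_const, gradv_lincomb (hE.differentiable two_ne_zero)
      (hQ.differentiable two_ne_zero), gradv_exp_neg_mul (hΦ.differentiable two_ne_zero)]
    simp only [dotProduct_add, dotProduct_smul, smul_eq_mul, dotProduct_gradv]
    have : 0 ≤ μ * κ * Real.exp (-κ * Φ (Fin.snoc x y)) := by positivity
    have := mul_nonneg this hΦpos.le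
    linarith
  · intro x hx y hy
    have hyI := hyI y hy
    obtain ⟨Φ₀, Φ₁, Φ₂⟩ := bΦ ε hε.le hε1 x hx y hyI
    obtain ⟨Q₀, Q₁, Q₂⟩ := bQ ε hε.le hε1 x hx y hyI
    rw [← hΦdef] at Φ₀ Φ₁ Φ₂
    rw [← hQdef] at Q₀ Q₁ Q₂
    have Φ₀' := abs_le.1 Φ₀
    have Q₀' := abs_le.1 Q₀
    have e₁ : μ * Real.exp (-κ * Φ (Fin.snoc x y)) ≤ μ * Real.exp (κ * CΦ) :=
      mul_le_mul_of_nonneg_left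
        (Real.exp_le_exp.2 (by linarith [mul_le_mul_of_nonneg_left Φ₀'.1 hκ.le])) hμ
    have e₂ : 0 ≤ μ * Real.exp (-κ * Φ (Fin.snoc x y)) := by positivity
    refine ⟨by simp only [C₀]; linarith, by linarith, fun i => ?_⟩
    have hell' : η / 4 ≤ ∑ j, (σ i x y *ᵥ gradv Φ (Fin.snoc x y)) j ^ 2 := by
      have h1 : ∀ j, |(σ i x y *ᵥ gradv Φ (Fin.snoc x y)) j -
          (σ i x 0 *ᵥ (Fin.snoc (gradv s x) (w x) : Fin (N + 1) → ℝ)) j| ≤ ε * Cd := fun j => by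
        refine (abs_mulVec_sub_mulVec_le _ _ _ _ j).trans ?_
        have t₁ : matnorm (σ i x y - σ i x 0) * ∑ j, |gradv Φ (Fin.snoc x y) j| ≤
            C * (ε * G) * CΦ :=
          mul_le_mul ((hlip i x hx y hyI).trans (mul_le_mul_of_nonneg_left hy hC)) Φ₁
            (Finset.sum_nonneg fun _ _ => abs_nonneg _) (by positivity)
        have t₂ := mul_le_mul (hσ i x hx 0 (by simp))
          (sum_abs_gradv_thinProfile_sub_le hsd hwd hgd hΛ.le hε.le hε1 hy (bw x hx).2.1
            (bg x hx).2.1 (bg x hx).1) (Finset.sum_nonneg fun _ _ => abs_nonneg _) hC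
        calc _ ≤ _ := add_le_add t₁ t₂
          _ = _ := by simp only [Cd]; ring
      have h2 := sum_sq_ge_of_abs_sub_le h1
      have h3 : k * (ε * Cd) ^ 2 ≤ ε * (k * Cd ^ 2) := by
        have : ε * (ε * (k * Cd ^ 2)) ≤ 1 * (ε * (k * Cd ^ 2)) :=
          mul_le_mul_of_nonneg_right hε1 (by positivity)
        linarith
      linarith [hell i x hx]
    refine le_elliptic_exp _ _ hΦ hQ hC (hσ i x hx y hyI) (hb i x hx y hyI) hell' Φ₁ Φ₂ Q₁ Q₂
      hκ.le hμ hκη ?_ C₀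
    have e₃ : Real.exp (-κ * CΦ) ≤ Real.exp (-κ * Φ (Fin.snoc x y)) :=
      Real.exp_le_exp.2 (by linarith [mul_le_mul_of_nonneg_left Φ₀'.2 hκ.le])
    rw [mul_assoc]
    exact hμT.trans (by gcongr)

/-- A pointwise positive lower bound for a family of quadratic forms is uniform on compact sets. -/
theorem exists_uniform_elliptic {N m n : ℕ} {ι : Type*} {S : Set (Fin N → ℝ)} (hS : IsCompact S)
    {A : ι → (Fin N → ℝ) → Matrix (Fin m) (Fin n) ℝ} {p : (Fin N → ℝ) → (Fin n → ℝ)}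
    (hp : Continuous p) {C : ℝ} (hA : ∀ i, ∀ x ∈ S, matnorm (A i x) ≤ C)
    (hlip : ∀ i, ∀ x ∈ S, ∀ x' ∈ S, matnorm (A i x - A i x') ≤ C * znorm (x - x') 0)
    (hell : ∀ x ∈ S, ∃ η > 0, ∀ i, η ≤ ∑ j, (A i x *ᵥ p x) j ^ 2) :
    ∃ η > 0, ∀ i, ∀ x ∈ S, η ≤ ∑ j, (A i x *ᵥ p x) j ^ 2 := by
  suffices ∃ η > 0, ∀ x ∈ S, x ∈ S → ∀ i, η ≤ ∑ j, (A i x *ᵥ p x) j ^ 2 by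
    obtain ⟨η, hη, h⟩ := this
    exact ⟨η, hη, fun i x hx => h x hx hx i⟩
  refine hS.induction_on (p := fun t => ∃ η > 0, ∀ x ∈ t, x ∈ S → ∀ i,
    η ≤ ∑ j, (A i x *ᵥ p x) j ^ 2) ⟨1, one_pos, by simp⟩ ?_ ?_ ?_
  · rintro s t hst ⟨η, hη, h⟩
    exact ⟨η, hη, fun x hx => h x (hst hx)⟩
  · rintro s t ⟨η₁, hη₁, h₁⟩ ⟨η₂, hη₂, h₂⟩
    refine ⟨min η₁ η₂, lt_min hη₁ hη₂, fun x hx hxS i => ?_⟩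
    rcases hx with hx | hx
    · exact (min_le_left _ _).trans (h₁ x hx hxS i)
    · exact (min_le_right _ _).trans (h₂ x hx hxS i)
  · intro x₀ hx₀
    obtain ⟨η, hη, h⟩ := hell x₀ hx₀
    let d : (Fin N → ℝ) → ℝ := fun x =>
      C * znorm (x - x₀) 0 * (∑ j, |p x j|) + C * ∑ j, |p x j - p x₀ j|
    have hd : Continuous fun x => m * d x ^ 2 := by
      simp only [d, znorm, Pi.sub_apply]
      fun_prop
    have hd₀ : m * d x₀ ^ 2 < η / 4 := by
      simp [d, znorm, hη]
    refine ⟨{x | m * d x ^ 2 < η / 4},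
      mem_nhdsWithin_of_mem_nhds (hd.continuousAt.eventually_lt continuousAt_const hd₀),
      η / 4, by positivity, fun x hx hxS i => ?_⟩
    have hq : ∀ j, |(A i x *ᵥ p x) j - (A i x₀ *ᵥ p x₀) j| ≤ d x := fun j => by
      refine (abs_mulVec_sub_mulVec_le _ _ _ _ j).trans ?_
      simp only [d]
      gcongr
      · exact hlip i x hxS x₀ hx₀
      · exact hA i x₀ hx₀
    have := sum_sq_ge_of_abs_sub_le hq
    have hx' : m * d x ^ 2 < η / 4 := hx
    linarith [h i]

/-- The function whose gradient realises the ellipticity condition may be taken of class `C³`. -/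
theorem exists_contDiff_three_elliptic {N k : ℕ} {ι : Type*} {S : Set (Fin N → ℝ)}
    (hS : IsCompact S) {A : ι → (Fin N → ℝ) → Matrix (Fin k) (Fin (N + 1)) ℝ}
    {C η : ℝ} (hC : 0 ≤ C) (hη : 0 < η) (hA : ∀ i, ∀ x ∈ S, matnorm (A i x) ≤ C)
    {γ₀ : (Fin N → ℝ) → (Fin N → ℝ)} (hγ₀ : Continuous γ₀) {s : (Fin N → ℝ) → ℝ}
    (hs : ContDiff ℝ 1 s)
    (hell : ∀ i, ∀ x ∈ S, η ≤ ∑ j, (A i x *ᵥ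
      (Fin.snoc (gradv s x) (-(dotProduct (gradv s x) (γ₀ x))) : Fin (N + 1) → ℝ)) j ^ 2) :
    ∃ t : (Fin N → ℝ) → ℝ, ContDiff ℝ 3 t ∧ ∀ i, ∀ x ∈ S, η / 4 ≤ ∑ j, (A i x *ᵥ
      (Fin.snoc (gradv t x) (-(dotProduct (gradv t x) (γ₀ x))) : Fin (N + 1) → ℝ)) j ^ 2 := by
  obtain ⟨V, hV⟩ := hS.exists_bound_of_continuousOn hγ₀.continuousOn
  let B := C * (N + |V| * N)
  have hB : 0 ≤ B := by positivity
  let d := min 1 (η / 4 / (k * B ^ 2 + 1))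
  have hd : 0 < d := by positivity
  have hd1 : d ≤ 1 := min_le_left _ _
  have hdη : d * (k * B ^ 2) ≤ η / 4 := by
    have h1 : d ≤ η / 4 / (k * B ^ 2 + 1) := min_le_right _ _
    rw [le_div_iff₀ (by positivity)] at h1
    linarith
  obtain ⟨t, ht, hts⟩ := exists_contDiff_C1_approx hs hS hd
  refine ⟨t, ht, fun i x hx => ?_⟩
  have hj : ∀ j, |gradv t x j - gradv s x j| ≤ d := fun j => by
    have h1 := (fderiv ℝ t x - fderiv ℝ s x).le_of_opNorm_le (hts x hx).2 (Pi.single j (1 : ℝ))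
    rwa [Pi.norm_single, norm_one, mul_one] at h1
  have hsum : ∑ j, |gradv t x j - gradv s x j| ≤ N * d := by
    simpa using Finset.sum_le_sum fun j (_ : j ∈ Finset.univ) => hj j
  have hlast : |dotProduct (gradv t x) (γ₀ x) - dotProduct (gradv s x) (γ₀ x)| ≤ |V| * (N * d) := by
    rw [← sub_dotProduct, dotProduct_comm]
    refine (abs_dotProduct_le fun j => ((norm_le_pi_norm (γ₀ x) j).trans (hV x hx)).trans
      (le_abs_self _)).trans (mul_le_mul_of_nonneg_left hsum (abs_nonneg _))
  have hq : ∀ j, |(A i x *ᵥ (Fin.snoc (gradv t x) (-(dotProduct (gradv t x) (γ₀ x))) :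
        Fin (N + 1) → ℝ)) j -
      (A i x *ᵥ (Fin.snoc (gradv s x) (-(dotProduct (gradv s x) (γ₀ x))) : Fin (N + 1) → ℝ)) j| ≤
      d * B := fun j => by
    refine (abs_mulVec_sub_mulVec_le _ _ _ _ j).trans ?_
    rw [Fin.sum_univ_castSucc]
    have h0 : matnorm (0 : Matrix (Fin k) (Fin (N + 1)) ℝ) = 0 := by simp [matnorm]
    simp only [sub_self, h0, zero_mul, zero_add, Fin.sum_univ_castSucc, Fin.snoc_castSucc,
      Fin.snoc_last, neg_sub_neg]
    rw [abs_sub_comm (gradv s x ⬝ᵥ γ₀ x)]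
    calc _ ≤ C * (N * d + |V| * (N * d)) :=
          mul_le_mul (hA i x hx) (add_le_add hsum hlast) (by positivity) hC
      _ = _ := by simp only [B]; ring
  have h2 := sum_sq_ge_of_abs_sub_le hq
  have h3 : k * (d * B) ^ 2 ≤ d * (k * B ^ 2) := by
    have : d * (d * (k * B ^ 2)) ≤ 1 * (d * (k * B ^ 2)) :=
      mul_le_mul_of_nonneg_right hd1 (by positivity)
    linarith
  linarith [hell i x hx]

/-- A smooth function can be inserted between two strictly ordered `C¹` functions on a compact
set. -/
theorem exists_contDiff_between {N : ℕ} {S : Set (Fin N → ℝ)} (hS : IsCompact S)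
    {gp gm : (Fin N → ℝ) → ℝ} (hgp : ContDiff ℝ 1 gp) (hgm : ContDiff ℝ 1 gm)
    (hgap : ∀ x ∈ S, gm x < gp x) :
    ∃ g : (Fin N → ℝ) → ℝ, ContDiff ℝ 2 g ∧ ∃ δ > 0, ∀ x ∈ S, gm x + δ ≤ g x ∧ g x + δ ≤ gp x := by
  obtain ⟨δ, hδ, h⟩ := hS.exists_forall_le' (hgp.continuous.sub hgm.continuous).continuousOn
    (a := 0) fun x hx => sub_pos.2 (hgap x hx)
  obtain ⟨g, hg, hgs⟩ := exists_contDiff_C1_approx ((hgp.add hgm).div_const 2) hS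
    (show 0 < δ / 4 by positivity)
  refine ⟨g, hg.of_le (by norm_num), δ / 4, by positivity, fun x hx => ?_⟩
  have h1 := abs_le.1 (hgs x hx).1
  have h2 := h x hx
  simp only [Pi.sub_apply] at h1 h2
  constructor <;> linarith

theorem iInf_iSup_pos {L M : Type*} [Nonempty L] [Nonempty M] {v : L → M → ℝ} {B : ℝ}
    (h : ∀ l m, 1 ≤ v l m) (hB : ∀ l m, |v l m| ≤ B) : 0 < ⨅ l, ⨆ m, v l m := by
  refine one_pos.trans_le (le_ciInf fun l => ?_)
  obtain ⟨m⟩ := ‹Nonempty M›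
  exact (h l m).trans (le_ciSup ⟨B, by rintro _ ⟨m, rfl⟩; exact (le_abs_self _).trans (hB l m)⟩ m)

theorem iInf_iSup_neg {L M : Type*} [Nonempty L] [Nonempty M] {v : L → M → ℝ} {B : ℝ}
    (h : ∀ l m, v l m ≤ -1) (hB : ∀ l m, |v l m| ≤ B) : ⨅ l, ⨆ m, v l m < 0 := by
  obtain ⟨l⟩ := ‹Nonempty L›
  refine (ciInf_le ⟨-B, ?_⟩ l).trans_lt ((ciSup_le (h l)).trans_lt (by norm_num))
  rintro _ ⟨l, rfl⟩
  obtain ⟨m⟩ := ‹Nonempty M›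
  exact (abs_le.1 (hB l m)).1.trans
    (le_ciSup ⟨B, by rintro _ ⟨m, rfl⟩; exact (le_abs_self _).trans (hB l m)⟩ m)

theorem abs_elliptic_le {m n : ℕ} {A : Matrix (Fin m) (Fin n) ℝ} {b : Fin n → ℝ} {c f C : ℝ}
    (hA : matnorm A ≤ C) (hb : vnorm b ≤ C) (hc : |c| ≤ C) (hf : |f| ≤ C)
    (X : Matrix (Fin n) (Fin n) ℝ) (p : Fin n → ℝ) (r : ℝ) :
    |-(trace (Aᵀ * A * X)) - dotProduct b p + c * r - f| ≤
      m * C ^ 2 * (∑ i, ∑ j, |X i j|) + C * (∑ j, |p j|) + C * |r| + C := by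
  have h1 := abs_le.1 (abs_trace_gram_mul_le A X hA)
  have h2 := abs_le.1 (abs_dotProduct_le (p := p) fun j => (abs_entry_le_vnorm b j).trans hb)
  have h3 : |c * r| ≤ C * |r| := by rw [abs_mul]; gcongr
  have h3 := abs_le.1 h3
  have h4 := abs_le.1 hf
  rw [abs_le]
  constructor <;> linarith [h1.1, h1.2, h2.1, h2.2, h3.1, h3.2, h4.1, h4.2]

theorem gradv_neg {n : ℕ} (u : (Fin n → ℝ) → ℝ) (z : Fin n → ℝ) :
    gradv (fun z => -u z) z = -gradv u z := by
  ext j; simp [gradv, fderiv_fun_neg]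

theorem hessv_neg {n : ℕ} (u : (Fin n → ℝ) → ℝ) (z : Fin n → ℝ) :
    hessv (fun z => -u z) z = -hessv u z := by
  ext i j; simp [hessv, fderiv_fun_neg]

/-- key lemma: under the standing assumptions, without strict monotonicity
in `r` but with the global ellipticity condition, there exist uniform strict classical
super- and sub-solutions `ψ̄_ε, ψ_ε` of the oblique boundary value problem in the thin
domains `Ω_ε`, for all small `ε`. -/
theorem stmt16
    (N k : ℕ) (hN : 0 < N) (hk : 0 < k)
    (Ω : Set (Fin N → ℝ)) (hΩo : IsOpen Ω) (hΩb : Bornology.IsBounded Ω)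
    (L M : Type*) [Nonempty L] [Nonempty M]
    (σ : L → M → (Fin N → ℝ) → ℝ → Matrix (Fin k) (Fin (N + 1)) ℝ)
    (b : L → M → (Fin N → ℝ) → ℝ → (Fin (N + 1) → ℝ))
    (c f : L → M → (Fin N → ℝ) → ℝ → ℝ)
    (C_F : ℝ) (hCF : 0 < C_F)
    (hσcont : ∀ l m, ContinuousOn (fun p : (Fin N → ℝ) × ℝ => σ l m p.1 p.2)
      (closure Ω ×ˢ Set.Icc (-1 : ℝ) 1))
    (hbcont : ∀ l m, ContinuousOn (fun p : (Fin N → ℝ) × ℝ => b l m p.1 p.2)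
      (closure Ω ×ˢ Set.Icc (-1 : ℝ) 1))
    (hccont : ∀ l m, ContinuousOn (fun p : (Fin N → ℝ) × ℝ => c l m p.1 p.2)
      (closure Ω ×ˢ Set.Icc (-1 : ℝ) 1))
    (hfcont : ∀ l m, ContinuousOn (fun p : (Fin N → ℝ) × ℝ => f l m p.1 p.2)
      (closure Ω ×ˢ Set.Icc (-1 : ℝ) 1))
    (hbd : ∀ l m, ∀ x ∈ closure Ω, ∀ y ∈ Set.Icc (-1 : ℝ) 1,
      matnorm (σ l m x y) ≤ C_F ∧ vnorm (b l m x y) ≤ C_F ∧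
      |c l m x y| ≤ C_F ∧ |f l m x y| ≤ C_F)
    (hlip : ∀ l m, ∀ x ∈ closure Ω, ∀ y ∈ Set.Icc (-1 : ℝ) 1,
      ∀ x' ∈ closure Ω, ∀ y' ∈ Set.Icc (-1 : ℝ) 1,
      matnorm (σ l m x y - σ l m x' y') ≤ C_F * znorm (x - x') (y - y') ∧
      vnorm (b l m x y - b l m x' y') ≤ C_F * znorm (x - x') (y - y'))
    (ω : ℝ → ℝ) (hωm : Monotone ω) (hω0 : ω 0 = 0) (hωc : ContinuousAt ω 0)
    (hmod : ∀ l m, ∀ x ∈ closure Ω, ∀ y ∈ Set.Icc (-1 : ℝ) 1,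
      ∀ x' ∈ closure Ω, ∀ y' ∈ Set.Icc (-1 : ℝ) 1,
      |c l m x y - c l m x' y'| ≤ ω (znorm (x - x') (y - y')) ∧
      |f l m x y - f l m x' y'| ≤ ω (znorm (x - x') (y - y')))
    (hcnn : ∀ l m, ∀ x ∈ closure Ω, ∀ y ∈ Set.Icc (-1 : ℝ) 1, 0 ≤ c l m x y)
    (γp γm : (Fin N → ℝ) → ℝ → (Fin N → ℝ)) (βp βm : (Fin N → ℝ) → ℝ → ℝ)
    (hγpc : ContinuousOn (fun p : (Fin N → ℝ) × ℝ => γp p.1 p.2)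
      (closure Ω ×ˢ Set.Icc (-1 : ℝ) 1))
    (hγmc : ContinuousOn (fun p : (Fin N → ℝ) × ℝ => γm p.1 p.2)
      (closure Ω ×ˢ Set.Icc (-1 : ℝ) 1))
    (hβpc : ContinuousOn (fun p : (Fin N → ℝ) × ℝ => βp p.1 p.2)
      (closure Ω ×ˢ Set.Icc (-1 : ℝ) 1))
    (hβmc : ContinuousOn (fun p : (Fin N → ℝ) × ℝ => βm p.1 p.2)
      (closure Ω ×ˢ Set.Icc (-1 : ℝ) 1))
    (γ₀ : (Fin N → ℝ) → (Fin N → ℝ)) (β₀ : (Fin N → ℝ) → ℝ)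
    (hγ₀ : ContDiff ℝ 2 γ₀) (hβ₀ : ContDiff ℝ 2 β₀)
    (K : ℝ) (hK : 0 < K)
    (hasym : ∀ x ∈ closure Ω, ∀ y ∈ Set.Icc (-1 : ℝ) 1,
      vnorm (γp x y - γ₀ x) ≤ K * |y| ∧ vnorm (γm x y + γ₀ x) ≤ K * |y| ∧
      |βp x y - β₀ x| ≤ K * |y| ∧ |βm x y + β₀ x| ≤ K * |y|)
    (s : (Fin N → ℝ) → ℝ) (hs : ContDiff ℝ 2 s)
    (hell : ∀ x ∈ closure Ω,
      0 < ⨅ lm : L × M,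
        dotProduct
          (vecMul (Fin.snoc (gradv s x) (-(dotProduct (gradv s x) (γ₀ x))))
            ((σ lm.1 lm.2 x 0)ᵀ * σ lm.1 lm.2 x 0))
          (Fin.snoc (gradv s x) (-(dotProduct (gradv s x) (γ₀ x)))))
    (gp gm : (Fin N → ℝ) → ℝ) (hgp : ContDiff ℝ 1 gp) (hgm : ContDiff ℝ 1 gm)
    (hgap : ∀ x ∈ closure Ω, gm x < gp x) :
    ∃ r ∈ Set.Ioo (0 : ℝ) 1, ∃ ε₁ ∈ Set.Ioo (0 : ℝ) 1, ∃ C : ℝ, 0 < C ∧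
      ∀ ε : ℝ, 0 < ε → ε < ε₁ →
        ∃ ψu ψl : (Fin (N + 1) → ℝ) → ℝ,
          ContDiff ℝ 2 ψu ∧ ContDiff ℝ 2 ψl ∧
          (∀ x ∈ closure Ω,
            0 < dotProduct (Fin.snoc (γp x (ε * gp x)) 1)
                  (gradv ψu (Fin.snoc x (ε * gp x))) - βp x (ε * gp x)) ∧
          (∀ x ∈ closure Ω,
            0 < dotProduct (Fin.snoc (γm x (ε * gm x)) (-1))
                  (gradv ψu (Fin.snoc x (ε * gm x))) - βm x (ε * gm x)) ∧
          (∀ x ∈ closure Ω, ∀ y ∈ Set.Icc (ε * gm x) (ε * gp x),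
            0 < ⨅ l : L, ⨆ m : M,
              (-(trace ((σ l m x y)ᵀ * σ l m x y * hessv ψu (Fin.snoc x y)))
                - dotProduct (b l m x y) (gradv ψu (Fin.snoc x y))
                + c l m x y * ψu (Fin.snoc x y) - f l m x y)) ∧
          (∀ x ∈ closure Ω,
            dotProduct (Fin.snoc (γp x (ε * gp x)) 1)
              (gradv ψl (Fin.snoc x (ε * gp x))) - βp x (ε * gp x) < 0) ∧
          (∀ x ∈ closure Ω,
            dotProduct (Fin.snoc (γm x (ε * gm x)) (-1))
              (gradv ψl (Fin.snoc x (ε * gm x))) - βm x (ε * gm x) < 0) ∧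
          (∀ x ∈ closure Ω, ∀ y ∈ Set.Icc (ε * gm x) (ε * gp x),
            (⨅ l : L, ⨆ m : M,
              (-(trace ((σ l m x y)ᵀ * σ l m x y * hessv ψl (Fin.snoc x y)))
                - dotProduct (b l m x y) (gradv ψl (Fin.snoc x y))
                + c l m x y * ψl (Fin.snoc x y) - f l m x y)) < 0) ∧
          (∀ x ∈ closure Ω, ∀ y ∈ Set.Icc (ε * gm x) (ε * gp x),
            -C < ψl (Fin.snoc x y) ∧ ψl (Fin.snoc x y) < ψu (Fin.snoc x y) ∧
              ψu (Fin.snoc x y) < C) := by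
  have hS : IsCompact (closure Ω) := hΩb.isCompact_closure
  have h0 : (0 : ℝ) ∈ Set.Icc (-1 : ℝ) 1 := by simp
  have hσ₀ : ∀ lm : L × M, ∀ x ∈ closure Ω, matnorm (σ lm.1 lm.2 x 0) ≤ C_F :=
    fun lm x hx => (hbd lm.1 lm.2 x hx 0 h0).1
  obtain ⟨η, hη, hη'⟩ := exists_uniform_elliptic (ι := L × M) hS
    (A := fun lm x => σ lm.1 lm.2 x 0)
    (p := fun x => (Fin.snoc (gradv s x) (-(dotProduct (gradv s x) (γ₀ x))) : Fin (N + 1) → ℝ))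
    (by
      have hgs : Continuous (gradv s) := continuous_pi fun j =>
        (ContDiff.gradv_apply (m := 1) (by norm_num; exact hs) j).continuous
      exact Continuous.finSnoc (A := fun _ => ℝ) hgs (hgs.dotProduct hγ₀.continuous).neg)
    hσ₀
    (fun lm x hx x' hx' => by simpa using (hlip lm.1 lm.2 x hx 0 h0 x' hx' 0 h0).1)
    (fun x hx => ⟨_, hell x hx, fun lm => by
      rw [← dotProduct_vecMul_gram]
      refine ciInf_le ⟨0, ?_⟩ lm
      rintro _ ⟨lm, rfl⟩
      exact (Finset.sum_nonneg fun _ _ => sq_nonneg _).trans_eq (dotProduct_vecMul_gram _ _).symm⟩)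
  obtain ⟨t, ht, htell⟩ := exists_contDiff_three_elliptic hS hCF.le hη hσ₀ hγ₀.continuous
    (hs.of_le one_le_two) hη'
  obtain ⟨g, hg, δ, hδ, hgδ⟩ := exists_contDiff_between hS hgp hgm hgap
  obtain ⟨G₁, hG₁⟩ := hS.exists_bound_of_continuousOn hgp.continuous.continuousOn
  obtain ⟨G₂, hG₂⟩ := hS.exists_bound_of_continuousOn hgm.continuous.continuousOn
  let G := max 0 (max G₁ G₂)
  have hG : 0 ≤ G := le_max_left _ _
  have hGp : ∀ x ∈ closure Ω, |gp x| ≤ G := fun x hx =>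
    (hG₁ x hx).trans ((le_max_left _ _).trans (le_max_right _ _))
  have hGm : ∀ x ∈ closure Ω, |gm x| ≤ G := fun x hx =>
    (hG₂ x hx).trans ((le_max_right _ _).trans (le_max_right _ _))
  have core := fun {β : (Fin N → ℝ) → ℝ} (hβ : ContDiff ℝ 2 β) =>
    exists_strict_supersolution (ι := L × M) hS (σ := fun lm => σ lm.1 lm.2)
      (b := fun lm => b lm.1 lm.2) hCF.le (fun lm x hx y hy => (hbd lm.1 lm.2 x hx y hy).1)
      (fun lm x hx y hy => (hbd lm.1 lm.2 x hx y hy).2.1)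
      (fun lm x hx y hy => by
        simpa [znorm, Real.sqrt_sq_eq_abs] using (hlip lm.1 lm.2 x hx y hy x hx 0 h0).1)
      hγ₀ hβ ht hg hK.le (show 0 < η / 4 by positivity) hδ hG htell (C_F + 1)
  obtain ⟨ε₁, hε₁, B₁, hB₁, H₁⟩ := core hβ₀
  obtain ⟨ε₂, hε₂, B₂, hB₂, H₂⟩ := core hβ₀.neg
  refine ⟨1 / 2, by norm_num, min ε₁ ε₂, ⟨lt_min hε₁.1 hε₂.1, (min_le_left _ _).trans_lt hε₁.2⟩,
    B₁ + B₂, by positivity, fun ε hε hεlt => ?_⟩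
  obtain ⟨hεG, u, hu, hub, hui⟩ := H₁ ε hε (hεlt.trans_le (min_le_left _ _))
  obtain ⟨-, v, hv, hvb, hvi⟩ := H₂ ε hε (hεlt.trans_le (min_le_right _ _))
  have hp : ∀ x ∈ closure Ω, |ε * gp x| ≤ ε * G := fun x hx => by
    rw [abs_mul, abs_of_pos hε]
    exact mul_le_mul_of_nonneg_left (hGp x hx) hε.le
  have hm : ∀ x ∈ closure Ω, |ε * gm x| ≤ ε * G := fun x hx => by
    rw [abs_mul, abs_of_pos hε]
    exact mul_le_mul_of_nonneg_left (hGm x hx) hε.le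
  have hy : ∀ x ∈ closure Ω, ∀ y ∈ Set.Icc (ε * gm x) (ε * gp x), |y| ≤ ε * G :=
    fun x hx y hy => abs_le.2 ⟨(abs_le.1 (hm x hx)).1.trans hy.1,
      hy.2.trans (abs_le.1 (hp x hx)).2⟩
  have hI : ∀ y, |y| ≤ ε * G → y ∈ Set.Icc (-1 : ℝ) 1 := fun y hy => abs_le.1 (hy.trans hεG)
  have hgapp : ∀ x ∈ closure Ω, ε * δ ≤ 1 * (ε * gp x - ε * g x) := fun x hx => by
    rw [one_mul, ← mul_sub]
    exact mul_le_mul_of_nonneg_left (by linarith [(hgδ x hx).2]) hε.le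
  have hgapm : ∀ x ∈ closure Ω, ε * δ ≤ -1 * (ε * gm x - ε * g x) := fun x hx => by
    have := mul_le_mul_of_nonneg_left (hgδ x hx).1 hε.le
    linarith
  refine ⟨u, fun z => -v z, hu, hv.neg, fun x hx => ?_, fun x hx => ?_, fun x hx y hxy => ?_,
    fun x hx => ?_, fun x hx => ?_, fun x hx y hxy => ?_, fun x hx y hxy => ?_⟩
  · obtain ⟨h1, -, h2, -⟩ := hasym x hx _ (hI _ (hp x hx))
    exact sub_pos.2 (hub x hx _ 1 _ _ (by simp) (hp x hx) (hgapp x hx) (by simpa using h1)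
      (by rwa [one_mul, abs_sub_comm]))
  · obtain ⟨-, h1, -, h2⟩ := hasym x hx _ (hI _ (hm x hx))
    exact sub_pos.2 (hub x hx _ (-1) _ _ (by simp) (hm x hx) (hgapm x hx) (by simpa using h1)
      (by rw [← abs_neg]; convert h2 using 2; ring))
  · have hyG := hy x hx y hxy
    have hb' := fun l m => hbd l m x hx y (hI y hyG)
    obtain ⟨h1, -, h2⟩ := hui x hx y hyG
    refine iInf_iSup_pos (fun l m => ?_) fun l m =>
      abs_elliptic_le (hb' l m).1 (hb' l m).2.1 (hb' l m).2.2.1 (hb' l m).2.2.2 _ _ _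
    have h3 := mul_nonneg (hcnn l m x hx y (hI y hyG)) h1.le
    linarith [h2 (l, m), (abs_le.1 (hb' l m).2.2.2).2]
  · obtain ⟨h1, -, h2, -⟩ := hasym x hx _ (hI _ (hp x hx))
    have h3 := hvb x hx _ 1 (-βp x (ε * gp x)) _ (by simp) (hp x hx) (hgapp x hx)
      (by simpa using h1) (by convert h2 using 2; ring)
    rw [gradv_neg, dotProduct_neg]
    linarith
  · obtain ⟨-, h1, -, h2⟩ := hasym x hx _ (hI _ (hm x hx))
    have h3 := hvb x hx _ (-1) (-βm x (ε * gm x)) _ (by simp) (hm x hx) (hgapm x hx)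
      (by simpa using h1) (by convert h2 using 2; ring)
    rw [gradv_neg, dotProduct_neg]
    linarith
  · have hyG := hy x hx y hxy
    have hb' := fun l m => hbd l m x hx y (hI y hyG)
    obtain ⟨h1, -, h2⟩ := hvi x hx y hyG
    refine iInf_iSup_neg (fun l m => ?_) fun l m =>
      abs_elliptic_le (hb' l m).1 (hb' l m).2.1 (hb' l m).2.2.1 (hb' l m).2.2.2 _ _ _
    have h3 := mul_nonneg (hcnn l m x hx y (hI y hyG)) h1.le
    rw [gradv_neg, hessv_neg, dotProduct_neg, mul_neg, trace_neg, mul_neg]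
    linarith [h2 (l, m), (abs_le.1 (hb' l m).2.2.2).1]
  · have h1 := hui x hx y (hy x hx y hxy)
    have h2 := hvi x hx y (hy x hx y hxy)
    exact ⟨by linarith [h2.2.1], by linarith [h2.1, h1.1], by linarith [h1.2.1]⟩
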